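/- Let t(n,j) denote the number of Cayley trees on the vertex set {1,…,n} having exactly j twists. Then t(1,0) = 1, t(1,j) = 0 for j ≥ 1, and for every integer n ≥ 2: t(n,0) = (n−1)·t(n−1,0), and for every integer j ≥ 1, t(n,j) = (n−1)·t(n−1,j) + (n+j−3)·t(n−1,j−1). (Equivalently, setting c(n,m) := t(n, m−n+1), the numbers c(n,m) satisfy c(n,m) = (n−1)·c(n−1,m−1) + (m−2)·c(n−1,m−2), the same recurrence as the numbers of increasing 1,2-trees with n vertices and m edges.) -/

import Mathlib

open SimpleGraph

/-- The set of neighbors of `v` having a smaller label. -/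
def lowerNbrs {n : ℕ} (G : SimpleGraph (Fin n)) (v : Fin n) : Set (Fin n) :=
  {x | G.Adj v x ∧ x < v}

/-- `G` is an increasing 1,2-tree: every vertex other than the first one has a nonempty
set of smaller neighbors, of cardinality at most 2, forming a clique. -/
def IsIncreasing12Tree {n : ℕ} (G : SimpleGraph (Fin n)) : Prop :=
  ∀ v : Fin n, 1 ≤ v.val →
    (lowerNbrs G v).Nonempty ∧ (lowerNbrs G v).ncard ≤ 2 ∧
      ∀ x ∈ lowerNbrs G v, ∀ y ∈ lowerNbrs G v, x ≠ y → G.Adj x y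

/-- The set of vertices reachable from `v` after deleting the edge `{u,v}`
(in a tree, the vertex set of the subtree rooted at `v` when `v` is the child endpoint). -/
def subtreeSet {n : ℕ} (G : SimpleGraph (Fin n)) (u v : Fin n) : Set (Fin n) :=
  {w | (G.deleteEdges {s(u, v)}).Reachable v w}

/-- `v` is the child endpoint of the edge `{u,v}`: after deleting this edge,
`v` is no longer reachable from the root. -/
def IsChild {n : ℕ} (G : SimpleGraph (Fin n)) (root u v : Fin n) : Prop :=
  G.Adj u v ∧ ¬ (G.deleteEdges {s(u, v)}).Reachable root v

/-- The minimal label occurring in a set of vertices (labels being `Fin.val`). -/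
noncomputable def minLabel {n : ℕ} (S : Set (Fin n)) : ℕ := sInf (Fin.val '' S)

/-- An edge `{u,v}` with child endpoint `v` is a twist if the minimal label in the
subtree rooted at `v` is smaller than the label of `u`. -/
def IsTwist {n : ℕ} (G : SimpleGraph (Fin n)) (root : Fin n) (e : Sym2 (Fin n)) : Prop :=
  ∃ u v : Fin n, e = s(u, v) ∧ IsChild G root u v ∧ minLabel (subtreeSet G u v) < u.val

/-- An edge `{u,v}` with child endpoint `v` is increasing if the label of `u` is smaller
than every label in the subtree rooted at `v`. -/
def IsIncreasingEdge {n : ℕ} (G : SimpleGraph (Fin n)) (root : Fin n) (e : Sym2 (Fin n)) : Prop :=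
  ∃ u v : Fin n, e = s(u, v) ∧ IsChild G root u v ∧ u.val < minLabel (subtreeSet G u v)

/-- The number of twists of `G` (with respect to the given root). -/
noncomputable def numTwists {n : ℕ} (G : SimpleGraph (Fin n)) (root : Fin n) : ℕ :=
  Nat.card {e : Sym2 (Fin n) // e ∈ G.edgeSet ∧ IsTwist G root e}

/-- The number of increasing 1,2-trees on `n` vertices with `m` edges. -/
noncomputable def numInc12Trees (n m : ℕ) : ℕ :=
  Nat.card {G : SimpleGraph (Fin n) // IsIncreasing12Tree G ∧ G.edgeSet.ncard = m}

/-- The number of Cayley trees on `n ≥ 1` vertices (rooted at the vertex with label 1)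
with exactly `j` twists. -/
noncomputable def numCayleyTwist (n j : ℕ) (h : 0 < n) : ℕ :=
  Nat.card {G : SimpleGraph (Fin n) // G.IsTree ∧ numTwists G ⟨0, h⟩ = j}

section Enumerators

open Polynomial

mutual
/-- The twist enumerator of the rooted trees on `n` labelled vertices. -/
noncomputable def rootedTreePoly : ℕ → ℚ[X]
  | 0 => 0
  | n + 1 => rootedForestPoly n + X * ∑ k : Fin n,
      (n.choose k : ℚ[X]) * (rootedTreePoly (k + 1) * rootedTreePoly (n - k))
termination_by n => 2 * n
decreasing_by all_goals omega

/-- The twist enumerator of the rooted forests on `n` labelled vertices, that is, of the trees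
on `n + 1` vertices rooted at the smallest one. -/
noncomputable def rootedForestPoly : ℕ → ℚ[X]
  | 0 => 1
  | n + 1 => ∑ k : Fin (n + 1),
      (n.choose k : ℚ[X]) * (rootedTreePoly (k + 1) * rootedForestPoly (n - k))
termination_by n => 2 * n + 1
decreasing_by all_goals omega
end

theorem rootedTreePoly_succ (n : ℕ) : rootedTreePoly (n + 1) = rootedForestPoly n +
    X * ∑ k ∈ Finset.range (n + 1),
      (n.choose k : ℚ[X]) * (rootedTreePoly (k + 1) * rootedTreePoly (n - k)) := by
  conv_lhs => rw [rootedTreePoly]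
  rw [Finset.sum_range_succ, Nat.sub_self]
  simp [rootedTreePoly.eq_1, Finset.sum_range]

theorem rootedForestPoly_succ (n : ℕ) : rootedForestPoly (n + 1) =
    ∑ k ∈ Finset.range (n + 1),
      (n.choose k : ℚ[X]) * (rootedTreePoly (k + 1) * rootedForestPoly (n - k)) := by
  conv_lhs => rw [rootedForestPoly]
  rw [Finset.sum_range]

/-- The exponential generating function of a sequence of polynomials. -/
noncomputable def expGenFun (a : ℕ → ℚ[X]) : PowerSeries ℚ[X] :=
  PowerSeries.mk fun n => ((n.factorial : ℚ)⁻¹) • a n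

/-- Differentiation of the coefficients of a power series. -/
noncomputable def coeffDeriv (f : PowerSeries ℚ[X]) : PowerSeries ℚ[X] :=
  PowerSeries.mk fun n => derivative (PowerSeries.coeff n f)

theorem coeffDeriv_add (f g : PowerSeries ℚ[X]) :
    coeffDeriv (f + g) = coeffDeriv f + coeffDeriv g := by
  ext1 n; simp [coeffDeriv]

theorem coeffDeriv_sub (f g : PowerSeries ℚ[X]) :
    coeffDeriv (f - g) = coeffDeriv f - coeffDeriv g := by
  ext1 n; simp [coeffDeriv]

theorem coeffDeriv_mul (f g : PowerSeries ℚ[X]) :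
    coeffDeriv (f * g) = coeffDeriv f * g + f * coeffDeriv g := by
  ext1 n
  simp [coeffDeriv, PowerSeries.coeff_mul, Finset.sum_add_distrib]

theorem coeffDeriv_C (p : ℚ[X]) :
    coeffDeriv (PowerSeries.C p) = PowerSeries.C (derivative p) := by
  ext1 n
  simp only [coeffDeriv, PowerSeries.coeff_mk, PowerSeries.coeff_C]
  split_ifs <;> simp

theorem coeffDeriv_X : coeffDeriv (PowerSeries.X : PowerSeries ℚ[X]) = 0 := by
  ext1 n
  simp only [coeffDeriv, PowerSeries.coeff_mk, PowerSeries.coeff_X]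
  split_ifs <;> simp

theorem coeffDeriv_derivative (f : PowerSeries ℚ[X]) :
    coeffDeriv (PowerSeries.derivative ℚ[X] f) =
      PowerSeries.derivative ℚ[X] (coeffDeriv f) := by
  ext1 n
  simp only [coeffDeriv, PowerSeries.coeff_mk, PowerSeries.coeff_derivative]
  rw [Polynomial.derivative_mul]
  simp

theorem derivative_expGenFun (a : ℕ → ℚ[X]) :
    PowerSeries.derivative ℚ[X] (expGenFun a) = expGenFun fun n => a (n + 1) := by
  ext1 n
  simp only [expGenFun, PowerSeries.coeff_mk, PowerSeries.coeff_derivative]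
  have h : ((n : ℚ[X]) + 1) = C ((n : ℚ) + 1) := by simp
  rw [h, mul_comm, ← Polynomial.smul_eq_C_mul, smul_smul, Nat.factorial_succ]
  congr 1
  push_cast
  have : (n.factorial : ℚ) ≠ 0 := by exact_mod_cast n.factorial_ne_zero
  field_simp

theorem expGenFun_mul (a b : ℕ → ℚ[X]) :
    expGenFun a * expGenFun b = expGenFun fun n =>
      ∑ k ∈ Finset.range (n + 1), (n.choose k : ℚ[X]) * (a k * b (n - k)) := by
  ext1 n
  simp only [expGenFun, PowerSeries.coeff_mk, PowerSeries.coeff_mul]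
  rw [Finset.Nat.sum_antidiagonal_eq_sum_range_succ
    (fun i j => ((i.factorial : ℚ)⁻¹ • a i) * ((j.factorial : ℚ)⁻¹ • b j)), Finset.smul_sum]
  refine Finset.sum_congr rfl fun k hk => ?_
  have hk' : k ≤ n := by simpa [Nat.lt_succ_iff] using hk
  have h : (n.choose k : ℚ[X]) = C (n.choose k : ℚ) := by simp
  rw [h, ← Polynomial.smul_eq_C_mul, smul_smul, smul_mul_smul_comm]
  congr 1
  rw [Nat.cast_choose ℚ hk']
  have h1 : (n.factorial : ℚ) ≠ 0 := by exact_mod_cast n.factorial_ne_zero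
  field_simp

theorem eq_zero_of_derivative_eq_mul {f z : PowerSeries ℚ[X]}
    (hz : PowerSeries.derivative ℚ[X] z = f * z) (h0 : PowerSeries.coeff 0 z = 0) : z = 0 := by
  ext1 n
  induction n using Nat.strong_induction_on with
  | _ n ih =>
    rcases n with _ | n
    · simpa using h0
    · have h := congrArg (PowerSeries.coeff n) hz
      rw [PowerSeries.coeff_derivative, PowerSeries.coeff_mul, Finset.sum_eq_zero] at h
      · have hn : ((n : ℚ[X]) + 1) ≠ 0 := by exact_mod_cast n.succ_ne_zero
        simpa [hn] using h
      · intro p hp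
        rw [ih p.2 (by have := Finset.HasAntidiagonal.mem_antidiagonal.1 hp; omega)]
        simp

theorem coeff_zero_coeffDeriv_eq (f : PowerSeries ℚ[X]) :
    PowerSeries.coeff 0 (coeffDeriv f) = derivative (PowerSeries.coeff 0 f) := by
  simp [coeffDeriv]

/-- If `H = exp R` and `R' = H + x R R'`, then `H` satisfies the linear partial differential
equation that encodes the recurrence for `rootedForestPoly`. -/
theorem expGenFun_pde {R H : PowerSeries ℚ[X]} {x : PowerSeries ℚ[X]} (hx : x = PowerSeries.C X)
    (hR0 : PowerSeries.coeff 0 R = 0) (hH0 : PowerSeries.coeff 0 H = 1)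
    (hR : PowerSeries.derivative ℚ[X] R = H + x * (PowerSeries.derivative ℚ[X] R * R))
    (hH : PowerSeries.derivative ℚ[X] H = PowerSeries.derivative ℚ[X] R * H) :
    PowerSeries.derivative ℚ[X] H = H + PowerSeries.X * PowerSeries.derivative ℚ[X] H
      + x * (PowerSeries.X * PowerSeries.derivative ℚ[X] H) + x * x * coeffDeriv H := by
  have dx : PowerSeries.derivative ℚ[X] x = 0 := by rw [hx]; exact PowerSeries.derivative_C
  have δx : coeffDeriv x = 1 := by rw [hx, coeffDeriv_C]; simp
  have δ1 : coeffDeriv 1 = 0 := by simpa using coeffDeriv_C 1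
  have d1 : PowerSeries.derivative ℚ[X] (1 : PowerSeries ℚ[X]) = 0 :=
    PowerSeries.derivative_one
  have dX : PowerSeries.derivative ℚ[X] (PowerSeries.X : PowerSeries ℚ[X]) = 1 :=
    PowerSeries.derivative_X
  have hE : (1 - x - PowerSeries.X) * H - (1 - x) + x * R = 0 := by
    refine eq_zero_of_derivative_eq_mul (f := PowerSeries.derivative ℚ[X] R) ?_ ?_
    · simp only [map_add, map_sub, Derivation.leibniz, dx, d1, dX, smul_eq_mul]
      rw [hH]
      linear_combination hR
    · simp only [PowerSeries.coeff_zero_eq_constantCoeff, map_add, map_sub, map_mul,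
        PowerSeries.constantCoeff_X, map_one] at *
      rw [hR0, hH0]; ring
  have hδH : coeffDeriv H - H * coeffDeriv R = 0 := by
    refine eq_zero_of_derivative_eq_mul (f := PowerSeries.derivative ℚ[X] R) ?_ ?_
    · have h := congrArg coeffDeriv hH
      rw [coeffDeriv_mul, coeffDeriv_derivative, coeffDeriv_derivative] at h
      simp only [map_sub, Derivation.leibniz, smul_eq_mul]
      linear_combination h - coeffDeriv R * hH
    · have h1 := coeff_zero_coeffDeriv_eq H
      have h2 := coeff_zero_coeffDeriv_eq R
      rw [hH0] at h1
      rw [hR0] at h2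
      simp only [PowerSeries.coeff_zero_eq_constantCoeff, map_sub, map_mul] at *
      rw [h1, h2]; simp
  have hδE := congrArg coeffDeriv hE
  rw [coeffDeriv_add, coeffDeriv_sub, coeffDeriv_mul, coeffDeriv_mul, coeffDeriv_sub,
    coeffDeriv_sub, δ1, δx, coeffDeriv_X] at hδE
  have δ0 : coeffDeriv 0 = 0 := by simpa using coeffDeriv_C 0
  rw [δ0] at hδE
  have hD : 1 - x * R ≠ 0 := by
    intro h
    have := congrArg (PowerSeries.coeff 0) h
    simp only [PowerSeries.coeff_zero_eq_constantCoeff, map_sub, map_mul, map_one] at *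
    rw [hR0] at this
    simp at this
  set R' := PowerSeries.derivative ℚ[X] R
  have hQ : (1 - PowerSeries.X - x * PowerSeries.X) * R' - 1 - x * x * coeffDeriv R = 0 := by
    refine (mul_eq_zero.1 (?_ : (1 - x * R) * _ = 0)).resolve_left hD
    have e1 : (1 - x * R) * R' = H := by linear_combination hR
    have e2 : (1 - x * R) * coeffDeriv R = H - 1 - R := by
      linear_combination hδE - (1 - x - PowerSeries.X) * hδH - coeffDeriv R * hE
    linear_combination (1 - PowerSeries.X - x * PowerSeries.X) * e1 - x * x * e2 + (1 + x) * hE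
  linear_combination H * hQ + (1 - PowerSeries.X - x * PowerSeries.X) * hH - x * x * hδH

theorem rootedForestPoly_recurrence (n : ℕ) : rootedForestPoly (n + 1) =
    (1 + (n : ℚ[X]) + (n : ℚ[X]) * X) * rootedForestPoly n + X ^ 2 * derivative (rootedForestPoly n) := by
  have h := expGenFun_pde (R := expGenFun rootedTreePoly) (H := expGenFun rootedForestPoly) rfl
    (by simp [expGenFun, rootedTreePoly]) (by simp [expGenFun, rootedForestPoly])
    (by
      rw [derivative_expGenFun, expGenFun_mul]
      ext1 n
      rw [map_add, PowerSeries.coeff_C_mul]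
      simp only [expGenFun, PowerSeries.coeff_mk]
      rw [rootedTreePoly_succ, smul_add, mul_smul_comm])
    (by
      rw [derivative_expGenFun, derivative_expGenFun, expGenFun_mul]
      simp only [rootedForestPoly_succ])
  have h := congrArg (PowerSeries.coeff n) h
  have hX : PowerSeries.coeff n (PowerSeries.X * PowerSeries.derivative ℚ[X]
      (expGenFun rootedForestPoly)) = (n : ℚ[X]) * PowerSeries.coeff n
      (expGenFun rootedForestPoly) := by
    rcases n with _ | n
    · simp
    · rw [PowerSeries.coeff_succ_X_mul, PowerSeries.coeff_derivative]; push_cast; ring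
  rw [map_add, map_add, map_add, hX, PowerSeries.coeff_C_mul, hX, mul_assoc (PowerSeries.C X),
    PowerSeries.coeff_C_mul, PowerSeries.coeff_C_mul, derivative_expGenFun] at h
  simp only [expGenFun, coeffDeriv, PowerSeries.coeff_mk, derivative_smul] at h
  have h1 : (n.factorial : ℚ)⁻¹ ≠ 0 := inv_ne_zero (by exact_mod_cast n.factorial_ne_zero)
  refine smul_right_injective ℚ[X] h1 ?_
  simp only
  rw [h]
  simp only [Polynomial.smul_eq_C_mul]
  ring

end Enumerators

/-- `G` is a tree with vertex set `S`, all other vertices being isolated. -/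
structure IsTreeOn {V : Type*} (S : Finset V) (G : SimpleGraph V) : Prop where
  mem_of_adj : ∀ ⦃u v⦄, G.Adj u v → u ∈ S
  reachable : ∀ ⦃u⦄, u ∈ S → ∀ ⦃v⦄, v ∈ S → G.Reachable u v
  isAcyclic : G.IsAcyclic

theorem SimpleGraph.Reachable.induction_adj {V : Type*} {G : SimpleGraph V} {P : V → Prop}
    {a w : V} (h : G.Reachable a w) (ha : P a) (hP : ∀ u v, P u → G.Adj u v → P v) : P w := by
  rw [reachable_iff_reflTransGen] at h
  induction h with
  | refl => exact ha
  | tail _ h ih => exact hP _ _ ih h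

namespace IsTreeOn

variable {V : Type*} {S : Finset V} {G : SimpleGraph V}

theorem reachable_iff (h : IsTreeOn S G) {c w : V} (hc : c ∈ S) : G.Reachable c w ↔ w ∈ S :=
  ⟨fun hr => hr.induction_adj (P := (· ∈ S)) hc fun _ _ _ hadj => h.mem_of_adj hadj.symm,
    fun hw => h.reachable hc hw⟩

theorem not_reachable_deleteEdges (h : IsTreeOn S G) {u v : V} (huv : G.Adj u v) :
    ¬ (G.deleteEdges {s(u, v)}).Reachable u v :=
  isAcyclic_iff_forall_adj_isBridge.1 h.isAcyclic huv

end IsTreeOn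

section Glue

variable {V : Type*} {A B : Finset V} {X Y : SimpleGraph V} {r c : V}

theorem reachable_glue_iff (hX : ∀ ⦃u v⦄, X.Adj u v → u ∈ A) (hY : ∀ ⦃u v⦄, Y.Adj u v → u ∈ B)
    (hAB : Disjoint A B) (hc : c ∈ A) (hr : r ∈ B) {a w : V} (ha : a ∈ A) :
    (X ⊔ Y ⊔ edge r c).Reachable a w ↔
      X.Reachable a w ∨ (X.Reachable a c ∧ Y.Reachable r w) := by
  have hne : r ≠ c := fun h => Finset.disjoint_left.1 hAB hc (h ▸ hr)
  constructor
  · intro h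
    refine h.induction_adj (P := fun w => X.Reachable a w ∨ (X.Reachable a c ∧ Y.Reachable r w))
      (Or.inl (Reachable.refl _)) fun u v hu huv => ?_
    have memX : ∀ {z}, X.Reachable a z → z ∈ A := fun hz =>
      hz.induction_adj (P := (· ∈ A)) ha fun _ _ _ hadj => hX hadj.symm
    have memY : ∀ {z}, Y.Reachable r z → z ∈ B := fun hz =>
      hz.induction_adj (P := (· ∈ B)) hr fun _ _ _ hadj => hY hadj.symm
    simp only [sup_adj, edge_adj] at huv
    rcases huv with (huv | huv) | ⟨⟨rfl, rfl⟩ | ⟨rfl, rfl⟩, -⟩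
    · rcases hu with hu | ⟨-, hu⟩
      · exact Or.inl (hu.trans huv.reachable)
      · exact (Finset.disjoint_left.1 hAB (hX huv) (memY hu)).elim
    · rcases hu with hu | ⟨hac, hu⟩
      · exact (Finset.disjoint_left.1 hAB (memX hu) (hY huv)).elim
      · exact Or.inr ⟨hac, hu.trans huv.reachable⟩
    · rcases hu with hu | ⟨hac, -⟩
      · exact (Finset.disjoint_left.1 hAB (memX hu) hr).elim
      · exact Or.inl hac
    · rcases hu with hu | ⟨hac, -⟩
      · exact Or.inr ⟨hu, Reachable.refl _⟩
      · exact Or.inr ⟨hac, Reachable.refl _⟩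
  · have hXG : X ≤ X ⊔ Y ⊔ edge r c := le_sup_left.trans le_sup_left
    have hYG : Y ≤ X ⊔ Y ⊔ edge r c := le_sup_right.trans le_sup_left
    rintro (h | ⟨h1, h2⟩)
    · exact h.mono hXG
    · refine (h1.mono hXG).trans (Reachable.trans (Adj.reachable ?_) (h2.mono hYG))
      simp [edge_adj, hne.symm]

theorem reachable_glue_iff' (hX : ∀ ⦃u v⦄, X.Adj u v → u ∈ A) (hY : ∀ ⦃u v⦄, Y.Adj u v → u ∈ B)
    (hAB : Disjoint A B) (hc : c ∈ A) (hr : r ∈ B) {b w : V} (hb : b ∈ B) :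
    (X ⊔ Y ⊔ edge r c).Reachable b w ↔
      Y.Reachable b w ∨ (Y.Reachable b r ∧ X.Reachable c w) := by
  rw [sup_comm X Y, edge_comm]
  exact reachable_glue_iff hY hX hAB.symm hr hc hb

theorem deleteEdges_glue_left (hY : ∀ ⦃u v⦄, Y.Adj u v → u ∈ B)
    (hAB : Disjoint A B) (hr : r ∈ B) {u v : V} (hu : u ∈ A) (hv : v ∈ A) :
    (X ⊔ Y ⊔ edge r c).deleteEdges {s(u, v)} = X.deleteEdges {s(u, v)} ⊔ Y ⊔ edge r c := by
  have h1 : u ∉ B := Finset.disjoint_left.1 hAB hu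
  have h2 : v ∉ B := Finset.disjoint_left.1 hAB hv
  have h3 : r ≠ u := fun h => h1 (h ▸ hr)
  have h4 : r ≠ v := fun h => h2 (h ▸ hr)
  ext a b
  have h5 : Y.Adj a b → s(a, b) ≠ s(u, v) := by
    intro hab he
    rcases Sym2.eq_iff.1 he with ⟨rfl, rfl⟩ | ⟨rfl, rfl⟩
    · exact h1 (hY hab)
    · exact h2 (hY hab)
  have h6 : (edge r c).Adj a b → s(a, b) ≠ s(u, v) := by
    intro hab he
    rw [edge_adj] at hab
    rcases Sym2.eq_iff.1 he with ⟨rfl, rfl⟩ | ⟨rfl, rfl⟩ <;> rcases hab with ⟨⟨rfl, -⟩ | ⟨-, rfl⟩, -⟩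
      <;> contradiction
  simp only [deleteEdges_adj, sup_adj, Set.mem_singleton_iff]
  tauto

theorem deleteEdges_glue_right (hX : ∀ ⦃u v⦄, X.Adj u v → u ∈ A)
    (hAB : Disjoint A B) (hc : c ∈ A) {u v : V} (hu : u ∈ B) (hv : v ∈ B) :
    (X ⊔ Y ⊔ edge r c).deleteEdges {s(u, v)} = X ⊔ Y.deleteEdges {s(u, v)} ⊔ edge r c := by
  rw [sup_comm X Y, edge_comm, deleteEdges_glue_left hX hAB.symm hc hu hv, sup_comm X]

theorem deleteEdges_glue_edge (hX : ∀ ⦃u v⦄, X.Adj u v → u ∈ A) (hY : ∀ ⦃u v⦄, Y.Adj u v → u ∈ B)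
    (hAB : Disjoint A B) (hc : c ∈ A) (hr : r ∈ B) :
    (X ⊔ Y ⊔ edge r c).deleteEdges {s(r, c)} = X ⊔ Y := by
  ext a b
  have h5 : X.Adj a b → s(a, b) ≠ s(r, c) := by
    intro hab he
    rcases Sym2.eq_iff.1 he with ⟨rfl, rfl⟩ | ⟨rfl, rfl⟩
    · exact Finset.disjoint_left.1 hAB (hX hab) hr
    · exact Finset.disjoint_left.1 hAB (hX hab.symm) hr
  have h6 : Y.Adj a b → s(a, b) ≠ s(r, c) := by
    intro hab he
    rcases Sym2.eq_iff.1 he with ⟨rfl, rfl⟩ | ⟨rfl, rfl⟩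
    · exact Finset.disjoint_left.1 hAB hc (hY hab.symm)
    · exact Finset.disjoint_left.1 hAB hc (hY hab)
  have h7 : (edge r c).Adj a b → s(a, b) = s(r, c) := by
    rw [edge_adj, Sym2.eq_iff]; exact And.left
  simp only [deleteEdges_adj, sup_adj, Set.mem_singleton_iff]
  tauto

theorem reachable_sup_iff (hX : ∀ ⦃u v⦄, X.Adj u v → u ∈ A) (hY : ∀ ⦃u v⦄, Y.Adj u v → u ∈ B)
    (hAB : Disjoint A B) {a w : V} (ha : a ∈ A) : (X ⊔ Y).Reachable a w ↔ X.Reachable a w := by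
  refine ⟨fun h => ?_, fun h => h.mono le_sup_left⟩
  refine (h.induction_adj (P := fun w => w ∈ A ∧ X.Reachable a w)
    ⟨ha, Reachable.refl _⟩ fun u v hu huv => ?_).2
  rcases huv with huv | huv
  · exact ⟨hX huv.symm, hu.2.trans huv.reachable⟩
  · exact (Finset.disjoint_left.1 hAB hu.1 (hY huv)).elim

/-- Joining two disjoint trees by an edge gives a tree. -/
theorem IsTreeOn.glue [DecidableEq V] (hX : IsTreeOn A X) (hY : IsTreeOn B Y)
    (hAB : Disjoint A B) (hc : c ∈ A) (hr : r ∈ B) : IsTreeOn (A ∪ B) (X ⊔ Y ⊔ edge r c) where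
  mem_of_adj := by
    intro u v huv
    simp only [sup_adj, edge_adj] at huv
    rw [Finset.mem_union]
    rcases huv with (huv | huv) | ⟨⟨rfl, rfl⟩ | ⟨rfl, rfl⟩, -⟩
    · exact Or.inl (hX.mem_of_adj huv)
    · exact Or.inr (hY.mem_of_adj huv)
    · exact Or.inr hr
    · exact Or.inl hc
  reachable := by
    have key : ∀ w ∈ A ∪ B, (X ⊔ Y ⊔ edge r c).Reachable c w := by
      intro w hw
      rw [reachable_glue_iff hX.mem_of_adj hY.mem_of_adj hAB hc hr hc]
      rcases Finset.mem_union.1 hw with hw | hw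
      · exact Or.inl (hX.reachable hc hw)
      · exact Or.inr ⟨Reachable.refl _, hY.reachable hr hw⟩
    exact fun u hu v hv => (key u hu).symm.trans (key v hv)
  isAcyclic := by
    rw [isAcyclic_iff_forall_adj_isBridge]
    intro u v huv
    rw [isBridge_iff]
    have hX' : ∀ {e : Set (Sym2 V)} ⦃u v⦄, (X.deleteEdges e).Adj u v → u ∈ A :=
      fun {e} u v h => hX.mem_of_adj (deleteEdges_le e h)
    have hY' : ∀ {e : Set (Sym2 V)} ⦃u v⦄, (Y.deleteEdges e).Adj u v → u ∈ B :=
      fun {e} u v h => hY.mem_of_adj (deleteEdges_le e h)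
    have hrc : ¬ ((X ⊔ Y ⊔ edge r c).deleteEdges {s(r, c)}).Reachable c r := by
      rw [deleteEdges_glue_edge hX.mem_of_adj hY.mem_of_adj hAB hc hr,
        reachable_sup_iff hX.mem_of_adj hY.mem_of_adj hAB hc, hX.reachable_iff hc]
      exact fun h => Finset.disjoint_left.1 hAB h hr
    simp only [sup_adj, edge_adj] at huv
    rcases huv with (huv | huv) | ⟨⟨rfl, rfl⟩ | ⟨rfl, rfl⟩, -⟩
    · have hu := hX.mem_of_adj huv
      have hv := hX.mem_of_adj huv.symm
      rw [deleteEdges_glue_left hY.mem_of_adj hAB hr hu hv,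
        reachable_glue_iff hX' hY.mem_of_adj hAB hc hr hu, hY.reachable_iff hr]
      rintro (h | ⟨-, h⟩)
      · exact hX.not_reachable_deleteEdges huv h
      · exact Finset.disjoint_left.1 hAB hv h
    · have hu := hY.mem_of_adj huv
      have hv := hY.mem_of_adj huv.symm
      rw [deleteEdges_glue_right hX.mem_of_adj hAB hc hu hv,
        reachable_glue_iff' hX.mem_of_adj hY' hAB hc hr hu, hX.reachable_iff hc]
      rintro (h | ⟨-, h⟩)
      · exact hY.not_reachable_deleteEdges huv h
      · exact Finset.disjoint_left.1 hAB h hv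
    · exact fun h => hrc h.symm
    · rwa [Sym2.eq_swap]

/-- In a glued tree, the far endpoint of the gluing edge is determined by any vertex of the
glued subtree. -/
theorem IsTreeOn.eq_of_reachable_glue (hX : IsTreeOn A X) (hY : IsTreeOn B Y)
    (hAB : Disjoint A B) (hc : c ∈ A) (hr : r ∈ B) {m d : V} (hm : m ∈ A)
    (hd : (X ⊔ Y ⊔ edge r c).Adj r d)
    (hdm : ((X ⊔ Y ⊔ edge r c).deleteEdges {s(r, d)}).Reachable d m) : d = c := by
  by_contra hne
  have hrA : r ∉ A := fun h => Finset.disjoint_left.1 hAB h hr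
  have hrd : Y.Adj r d := by
    simp only [sup_adj, edge_adj] at hd
    rcases hd with (hd | hd) | ⟨⟨-, rfl⟩ | ⟨rfl, -⟩, -⟩
    · exact (hrA (hX.mem_of_adj hd)).elim
    · exact hd
    · exact (hne rfl).elim
    · exact (hrA hc).elim
  have hdB := hY.mem_of_adj hrd.symm
  rw [deleteEdges_glue_right hX.mem_of_adj hAB hc hr hdB,
    reachable_glue_iff' hX.mem_of_adj (fun u v h => hY.mem_of_adj (deleteEdges_le _ h))
      hAB hc hr hdB] at hdm
  rcases hdm with h | ⟨h, -⟩
  · exact Finset.disjoint_left.1 hAB hm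
      ((hY.reachable_iff hdB).1 (h.mono (deleteEdges_le _)))
  · exact hY.not_reachable_deleteEdges hrd h.symm

/-- In a glued tree, the part split off by the gluing edge. -/
theorem IsTreeOn.reachable_deleteEdges_glue_iff (hX : IsTreeOn A X) (hY : IsTreeOn B Y)
    (hAB : Disjoint A B) (hc : c ∈ A) (hr : r ∈ B) {w : V} :
    ((X ⊔ Y ⊔ edge r c).deleteEdges {s(r, c)}).Reachable c w ↔ w ∈ A := by
  rw [deleteEdges_glue_edge hX.mem_of_adj hY.mem_of_adj hAB hc hr,
    reachable_sup_iff hX.mem_of_adj hY.mem_of_adj hAB hc, hX.reachable_iff hc]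

theorem exists_adj_reachable_deleteEdges {G : SimpleGraph V} {r m : V} (hrm : G.Reachable r m)
    (hne : m ≠ r) : ∃ c, G.Adj r c ∧ (G.deleteEdges {s(r, c)}).Reachable c m := by
  refine (hrm.induction_adj (P := fun w => w = r ∨
    ∃ c, G.Adj r c ∧ (G.deleteEdges {s(r, c)}).Reachable c w) (Or.inl rfl) ?_).resolve_left hne
  rintro u v (rfl | ⟨c, hc, hcu⟩) huv
  · exact Or.inr ⟨v, huv, Reachable.refl _⟩
  · by_cases he : s(u, v) = s(r, c)
    · rcases Sym2.eq_iff.1 he with ⟨rfl, rfl⟩ | ⟨rfl, rfl⟩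
      · exact Or.inr ⟨v, hc, Reachable.refl _⟩
      · exact Or.inl rfl
    · refine Or.inr ⟨c, hc, hcu.trans (Adj.reachable ?_)⟩
      rw [deleteEdges_adj]
      exact ⟨huv, he⟩

theorem IsTreeOn.exists_eq_glue [DecidableEq V] {S : Finset V} {G : SimpleGraph V}
    (hG : IsTreeOn S G) {r m : V}
    (hr : r ∈ S) (hm : m ∈ S) (hne : m ≠ r) : ∃ A ⊆ S, m ∈ A ∧ r ∉ A ∧ ∃ c ∈ A, ∃ X Y,
      IsTreeOn A X ∧ IsTreeOn (S \ A) Y ∧ G = X ⊔ Y ⊔ edge r c := by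
  classical
  obtain ⟨c, hrc, hcm⟩ := exists_adj_reachable_deleteEdges (hG.reachable hr hm) hne
  let A := S.filter fun w => (G.deleteEdges {s(r, c)}).Reachable c w
  have hrA : r ∉ A := fun h =>
    hG.not_reachable_deleteEdges hrc (Finset.mem_filter.1 h).2.symm
  have hcA : c ∈ A := Finset.mem_filter.2 ⟨hG.mem_of_adj hrc.symm, Reachable.refl _⟩
  have hrB : r ∈ S \ A := Finset.mem_sdiff.2 ⟨hr, hrA⟩
  let sub : Finset V → SimpleGraph V := fun T =>
    { Adj := fun u v => G.Adj u v ∧ u ∈ T ∧ v ∈ T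
      symm := ⟨fun u v h => ⟨h.1.symm, h.2.2, h.2.1⟩⟩
      loopless := ⟨fun u h => G.loopless.irrefl u h.1⟩ }
  have hsub : ∀ T, sub T ≤ G := fun T u v h => h.1
  have hmem : ∀ T ⦃u v⦄, (sub T).Adj u v → u ∈ T := fun T u v h => h.2.1
  have hdis : Disjoint A (S \ A) := Finset.disjoint_sdiff
  have hcross : ∀ u v, G.Adj u v → u ∈ A → v ∉ A → u = c ∧ v = r := by
    intro u v huv hu hv
    by_cases he : s(u, v) = s(r, c)
    · rcases Sym2.eq_iff.1 he with ⟨rfl, rfl⟩ | ⟨rfl, rfl⟩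
      · exact (hrA hu).elim
      · exact ⟨rfl, rfl⟩
    · refine (hv (Finset.mem_filter.2 ⟨hG.mem_of_adj huv.symm,
        (Finset.mem_filter.1 hu).2.trans (Adj.reachable ?_)⟩)).elim
      rw [deleteEdges_adj]
      exact ⟨huv, he⟩
  have heq : G = sub A ⊔ sub (S \ A) ⊔ edge r c := by
    ext u v
    constructor
    · intro huv
      have hu := hG.mem_of_adj huv
      have hv := hG.mem_of_adj huv.symm
      by_cases huA : u ∈ A <;> by_cases hvA : v ∈ A
      · exact Or.inl (Or.inl ⟨huv, huA, hvA⟩)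
      · obtain ⟨rfl, rfl⟩ := hcross u v huv huA hvA
        exact Or.inr (by simp [edge_adj, huv.ne])
      · obtain ⟨rfl, rfl⟩ := hcross v u huv.symm hvA huA
        exact Or.inr (by simp [edge_adj, huv.ne])
      · exact Or.inl (Or.inr ⟨huv, Finset.mem_sdiff.2 ⟨hu, huA⟩, Finset.mem_sdiff.2 ⟨hv, hvA⟩⟩)
    · rintro ((h | h) | h)
      · exact h.1
      · exact h.1
      · rw [edge_adj] at h
        rcases h with ⟨⟨rfl, rfl⟩ | ⟨rfl, rfl⟩, -⟩
        · exact hrc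
        · exact hrc.symm
  refine ⟨A, Finset.filter_subset _ _, Finset.mem_filter.2 ⟨hm, hcm⟩, hrA, c, hcA, sub A,
    sub (S \ A), ⟨hmem A, ?_, hG.isAcyclic.anti (hsub A)⟩,
    ⟨hmem (S \ A), ?_, hG.isAcyclic.anti (hsub _)⟩, heq⟩
  · have key : ∀ w ∈ A, (sub A).Reachable c w := by
      intro w hw
      have h := hG.reachable (hG.mem_of_adj hrc.symm) (Finset.mem_filter.1 hw).1
      rw [heq, reachable_glue_iff (hmem A) (hmem _) hdis hcA hrB hcA] at h
      refine h.resolve_right fun h => ?_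
      have := h.2.induction_adj (P := (· ∈ S \ A)) hrB fun _ _ _ hadj => hmem _ hadj.symm
      exact Finset.disjoint_left.1 hdis hw this
    exact fun u hu v hv => (key u hu).symm.trans (key v hv)
  · have key : ∀ w ∈ S \ A, (sub (S \ A)).Reachable r w := by
      intro w hw
      have h := hG.reachable hr (Finset.mem_sdiff.1 hw).1
      rw [heq, reachable_glue_iff' (hmem A) (hmem _) hdis hcA hrB hrB] at h
      refine h.resolve_right fun h => ?_
      have := h.2.induction_adj (P := (· ∈ A)) hcA fun _ _ _ hadj => hmem _ hadj.symm
      exact Finset.disjoint_left.1 hdis this hw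
    exact fun u hu v hv => (key u hu).symm.trans (key v hv)

end Glue

section Twists

variable {n : ℕ} {A B : Finset (Fin n)} {X Y : SimpleGraph (Fin n)} {r c : Fin n}

theorem isChild_glue_left_iff (hX : IsTreeOn A X) (hY : IsTreeOn B Y) (hAB : Disjoint A B)
    (hc : c ∈ A) (hr : r ∈ B) {u v : Fin n} (huv : X.Adj u v) :
    IsChild (X ⊔ Y ⊔ edge r c) r u v ↔ IsChild X c u v := by
  have hu := hX.mem_of_adj huv
  have hv := hX.mem_of_adj huv.symm
  have hvr : ¬ (Y.Reachable r v) := fun h =>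
    Finset.disjoint_left.1 hAB hv ((hY.reachable_iff hr).1 h)
  have hadj : (X ⊔ Y ⊔ edge r c).Adj u v := Or.inl (Or.inl huv)
  rw [IsChild, IsChild, deleteEdges_glue_left hY.mem_of_adj hAB hr hu hv,
    reachable_glue_iff' (fun u v h => hX.mem_of_adj (deleteEdges_le _ h)) hY.mem_of_adj
      hAB hc hr hr]
  simp [hvr, hadj, huv]

theorem isChild_glue_right_iff (hX : IsTreeOn A X) (hY : IsTreeOn B Y) (hAB : Disjoint A B)
    (hc : c ∈ A) (hr : r ∈ B) {u v : Fin n} (huv : Y.Adj u v) :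
    IsChild (X ⊔ Y ⊔ edge r c) r u v ↔ IsChild Y r u v := by
  have hu := hY.mem_of_adj huv
  have hv := hY.mem_of_adj huv.symm
  have hvc : ¬ (X.Reachable c v) := fun h =>
    Finset.disjoint_left.1 hAB ((hX.reachable_iff hc).1 h) hv
  have hadj : (X ⊔ Y ⊔ edge r c).Adj u v := Or.inl (Or.inr huv)
  rw [IsChild, IsChild, deleteEdges_glue_right hX.mem_of_adj hAB hc hu hv,
    reachable_glue_iff' hX.mem_of_adj (fun u v h => hY.mem_of_adj (deleteEdges_le _ h))
      hAB hc hr hr]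
  simp [hvc, hadj, huv]

theorem subtreeSet_glue_left (hX : IsTreeOn A X) (hY : IsTreeOn B Y) (hAB : Disjoint A B)
    (hc : c ∈ A) (hr : r ∈ B) {u v : Fin n} (huv : IsChild X c u v) :
    subtreeSet (X ⊔ Y ⊔ edge r c) u v = subtreeSet X u v := by
  have hu := hX.mem_of_adj huv.1
  have hv := hX.mem_of_adj huv.1.symm
  ext w
  rw [subtreeSet, subtreeSet, Set.mem_ofPred_eq, Set.mem_ofPred_eq,
    deleteEdges_glue_left hY.mem_of_adj hAB hr hu hv,
    reachable_glue_iff (fun u v h => hX.mem_of_adj (deleteEdges_le _ h)) hY.mem_of_adj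
      hAB hc hr hv]
  exact or_iff_left fun h => huv.2 h.1.symm

theorem subtreeSet_glue_right (hX : IsTreeOn A X) (hY : IsTreeOn B Y) (hAB : Disjoint A B)
    (hc : c ∈ A) (hr : r ∈ B) {u v : Fin n} (huv : IsChild Y r u v) :
    subtreeSet (X ⊔ Y ⊔ edge r c) u v = subtreeSet Y u v := by
  have hu := hY.mem_of_adj huv.1
  have hv := hY.mem_of_adj huv.1.symm
  ext w
  rw [subtreeSet, subtreeSet, Set.mem_ofPred_eq, Set.mem_ofPred_eq,
    deleteEdges_glue_right hX.mem_of_adj hAB hc hu hv,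
    reachable_glue_iff' hX.mem_of_adj (fun u v h => hY.mem_of_adj (deleteEdges_le _ h))
      hAB hc hr hv]
  exact or_iff_left fun h => huv.2 h.1.symm

theorem isTwist_glue_iff (hX : IsTreeOn A X) (hY : IsTreeOn B Y) (hAB : Disjoint A B)
    (hc : c ∈ A) (hr : r ∈ B) {e : Sym2 (Fin n)} :
    IsTwist (X ⊔ Y ⊔ edge r c) r e ↔
      IsTwist X c e ∨ IsTwist Y r e ∨ (e = s(r, c) ∧ minLabel (A : Set (Fin n)) < r.val) := by
  have hne : r ≠ c := fun h => Finset.disjoint_left.1 hAB hc (h ▸ hr)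
  have hrc : (X ⊔ Y ⊔ edge r c).Adj r c := Or.inr (by simp [edge_adj, hne])
  have hsub : subtreeSet (X ⊔ Y ⊔ edge r c) r c = A := by
    ext w
    exact hX.reachable_deleteEdges_glue_iff hY hAB hc hr
  constructor
  · rintro ⟨u, v, rfl, hch, hmin⟩
    have huv := hch.1
    simp only [sup_adj, edge_adj] at huv
    rcases huv with (huv | huv) | ⟨⟨rfl, rfl⟩ | ⟨rfl, rfl⟩, -⟩
    · rw [isChild_glue_left_iff hX hY hAB hc hr huv] at hch
      rw [subtreeSet_glue_left hX hY hAB hc hr hch] at hmin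
      exact Or.inl ⟨u, v, rfl, hch, hmin⟩
    · rw [isChild_glue_right_iff hX hY hAB hc hr huv] at hch
      rw [subtreeSet_glue_right hX hY hAB hc hr hch] at hmin
      exact Or.inr (Or.inl ⟨u, v, rfl, hch, hmin⟩)
    · rw [hsub] at hmin
      exact Or.inr (Or.inr ⟨rfl, hmin⟩)
    · exact (hch.2 (Reachable.refl _)).elim
  · rintro (⟨u, v, rfl, hch, hmin⟩ | ⟨u, v, rfl, hch, hmin⟩ | ⟨rfl, hmin⟩)
    · exact ⟨u, v, rfl, (isChild_glue_left_iff hX hY hAB hc hr hch.1).2 hch,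
        by rwa [subtreeSet_glue_left hX hY hAB hc hr hch]⟩
    · exact ⟨u, v, rfl, (isChild_glue_right_iff hX hY hAB hc hr hch.1).2 hch,
        by rwa [subtreeSet_glue_right hX hY hAB hc hr hch]⟩
    · refine ⟨r, c, rfl, ⟨hrc, fun h => ?_⟩, by rwa [hsub]⟩
      exact Finset.disjoint_left.1 hAB
        ((hX.reachable_deleteEdges_glue_iff hY hAB hc hr).1 h.symm) hr

theorem IsTwist.mem_edgeSet {G : SimpleGraph (Fin n)} {r : Fin n} {e : Sym2 (Fin n)}
    (h : IsTwist G r e) : e ∈ G.edgeSet := by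
  obtain ⟨u, v, rfl, hch, -⟩ := h
  exact hch.1

theorem numTwists_eq_ncard (G : SimpleGraph (Fin n)) (r : Fin n) :
    numTwists G r = {e | IsTwist G r e}.ncard := by
  rw [numTwists, ← Nat.card_coe_set_eq]
  exact Nat.card_congr (Equiv.subtypeEquivRight fun e => ⟨And.right, fun h => ⟨h.mem_edgeSet, h⟩⟩)

theorem numTwists_glue (hX : IsTreeOn A X) (hY : IsTreeOn B Y) (hAB : Disjoint A B)
    (hc : c ∈ A) (hr : r ∈ B) :
    numTwists (X ⊔ Y ⊔ edge r c) r = numTwists X c + numTwists Y r +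
      if minLabel (A : Set (Fin n)) < r.val then 1 else 0 := by
  have memX : ∀ u v, s(u, v) ∈ X.edgeSet → u ∈ A ∧ v ∈ A := fun u v h =>
    ⟨hX.mem_of_adj h, hX.mem_of_adj h.symm⟩
  have memY : ∀ u v, s(u, v) ∈ Y.edgeSet → u ∈ B ∧ v ∈ B := fun u v h =>
    ⟨hY.mem_of_adj h, hY.mem_of_adj h.symm⟩
  have hset : {e | IsTwist (X ⊔ Y ⊔ edge r c) r e} = ({e | IsTwist X c e} ∪ {e | IsTwist Y r e}) ∪
      {e | e = s(r, c) ∧ minLabel (A : Set (Fin n)) < r.val} := by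
    ext e
    simp only [Set.mem_union, Set.mem_ofPred_eq, isTwist_glue_iff hX hY hAB hc hr, or_assoc]
  rw [numTwists_eq_ncard, numTwists_eq_ncard, numTwists_eq_ncard, hset,
    Set.ncard_union_eq, Set.ncard_union_eq]
  · congr 1
    split_ifs with h <;> simp [h]
  · rw [Set.disjoint_left]
    rintro ⟨u, v⟩ h1 h2
    exact Finset.disjoint_left.1 hAB (memX u v h1.mem_edgeSet).1 (memY u v h2.mem_edgeSet).1
  · rw [Set.disjoint_left]
    rintro _ (h1 | h1) ⟨rfl, -⟩
    · exact Finset.disjoint_left.1 hAB (memX _ _ h1.mem_edgeSet).1 hr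
    · exact Finset.disjoint_left.1 hAB hc (memY _ _ h1.mem_edgeSet).2

theorem minLabel_lt_iff {S : Set (Fin n)} (hS : S.Nonempty) {k : ℕ} :
    minLabel S < k ↔ ∃ a ∈ S, a.val < k := by
  rw [minLabel, csInf_lt_iff (OrderBot.bddBelow _) (hS.image _)]
  simp

end Twists

section Counting

open Polynomial

variable {n : ℕ}

open Classical in
/-- The trees with vertex set `S`. -/
noncomputable def treesOn (S : Finset (Fin n)) : Finset (SimpleGraph (Fin n)) :=
  Finset.univ.filter (IsTreeOn S)

theorem mem_treesOn {S : Finset (Fin n)} {G : SimpleGraph (Fin n)} :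
    G ∈ treesOn S ↔ IsTreeOn S G := by
  simp [treesOn]

/-- The twist enumerator of the trees with vertex set `S` rooted at `r`. -/
noncomputable def twistPoly (S : Finset (Fin n)) (r : Fin n) : ℚ[X] :=
  ∑ G ∈ treesOn S, X ^ numTwists G r

theorem twistPoly_singleton (r : Fin n) : twistPoly {r} r = 1 := by
  have h : treesOn {r} = {⊥} := by
    ext G
    rw [mem_treesOn, Finset.mem_singleton]
    constructor
    · intro h
      ext u v
      simp only [bot_adj, iff_false]
      intro huv
      have h1 := Finset.mem_singleton.1 (h.mem_of_adj huv)
      have h2 := Finset.mem_singleton.1 (h.mem_of_adj huv.symm)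
      exact huv.ne (h1.trans h2.symm)
    · rintro rfl
      refine ⟨fun u v h => h.elim, fun u hu v hv => ?_, isAcyclic_bot⟩
      rw [Finset.mem_singleton.1 hu, Finset.mem_singleton.1 hv]
  have h0 : numTwists (⊥ : SimpleGraph (Fin n)) r = 0 := by
    simp [numTwists]
  rw [twistPoly, h, Finset.sum_singleton, h0, pow_zero]

/-- Splitting off the subtree containing `m` at the root. -/
theorem twistPoly_eq_sum_split {S : Finset (Fin n)} {r m : Fin n} (hr : r ∈ S) (hm : m ∈ S)
    (hne : m ≠ r) : twistPoly S r =
      ∑ A ∈ S.powerset with m ∈ A ∧ r ∉ A, (∑ c ∈ A, twistPoly A c) * twistPoly (S \ A) r *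
        (if minLabel (A : Set (Fin n)) < r.val then X else 1) := by
  have hsum : ∀ A : Finset (Fin n), (∑ c ∈ A, twistPoly A c) * twistPoly (S \ A) r *
      (if minLabel (A : Set (Fin n)) < r.val then X else 1) =
      ∑ p ∈ A ×ˢ (treesOn A ×ˢ treesOn (S \ A)), X ^ (numTwists p.2.1 p.1 + numTwists p.2.2 r +
        if minLabel (A : Set (Fin n)) < r.val then 1 else 0) := by
    intro A
    rw [Finset.sum_product]
    simp only [Finset.sum_product, twistPoly, Finset.sum_mul, Finset.mul_sum]
    rw [Finset.sum_comm]
    refine Finset.sum_congr rfl fun c _ => ?_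
    rw [Finset.sum_comm]
    refine Finset.sum_congr rfl fun Z _ => Finset.sum_congr rfl fun Z' _ => ?_
    split_ifs <;> simp [pow_add]
  simp only [hsum]
  rw [Finset.sum_sigma', twistPoly]
  symm
  refine Finset.sum_nbij (fun p => p.2.2.1 ⊔ p.2.2.2 ⊔ edge r p.2.1) ?_ ?_ ?_ ?_
  · rintro ⟨A, c, Z, Z'⟩ hp
    simp only [Finset.mem_sigma, Finset.mem_filter, Finset.mem_powerset, Finset.mem_product,
      mem_treesOn] at hp ⊢
    obtain ⟨⟨hAS, hmA, hrA⟩, hc, hZ, hZ'⟩ := hp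
    have := hZ.glue hZ' Finset.disjoint_sdiff hc (Finset.mem_sdiff.2 ⟨hr, hrA⟩)
    rwa [Finset.union_sdiff_of_subset hAS] at this
  · rintro ⟨A, c, Z, Z'⟩ hp ⟨A₂, c₂, Z₂, Z₂'⟩ hp₂ heq
    simp only [Finset.coe_sigma, Set.mem_sigma_iff, Finset.mem_coe, Finset.mem_filter,
      Finset.mem_powerset, Finset.mem_product, mem_treesOn] at hp hp₂ heq
    obtain ⟨⟨hAS, hmA, hrA⟩, hc, hZ, hZ'⟩ := hp
    obtain ⟨⟨hAS₂, hmA₂, hrA₂⟩, hc₂, hZ₂, hZ₂'⟩ := hp₂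
    have hrB := Finset.mem_sdiff.2 ⟨hr, hrA⟩
    have hrB₂ := Finset.mem_sdiff.2 ⟨hr, hrA₂⟩
    have hcc : c₂ = c := by
      refine hZ.eq_of_reachable_glue hZ' Finset.disjoint_sdiff hc hrB hmA ?_ ?_
      · rw [heq]
        exact Or.inr (by
          have : r ≠ c₂ := fun h => hrA₂ (h ▸ hc₂)
          simp [edge_adj, this])
      · rw [heq]
        exact (hZ₂.reachable_deleteEdges_glue_iff hZ₂' Finset.disjoint_sdiff hc₂ hrB₂).2 hmA₂
    subst hcc
    have hAA : A = A₂ := by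
      ext w
      rw [← hZ.reachable_deleteEdges_glue_iff hZ' Finset.disjoint_sdiff hc hrB, heq,
        hZ₂.reachable_deleteEdges_glue_iff hZ₂' Finset.disjoint_sdiff hc₂ hrB₂]
    subst hAA
    have hadj : ∀ u v, (Z.Adj u v ∨ Z'.Adj u v) ∨ (edge r c₂).Adj u v ↔
        (Z₂.Adj u v ∨ Z₂'.Adj u v) ∨ (edge r c₂).Adj u v := fun u v => by
      simpa only [sup_adj] using iff_of_eq (congrArg (fun G => G.Adj u v) heq)
    have h1 : ∀ u v, u ∈ A → v ∈ A → ¬ (edge r c₂).Adj u v := by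
      intro u v hu hv h
      rw [edge_adj] at h
      rcases h with ⟨⟨rfl, -⟩ | ⟨-, rfl⟩, -⟩ <;> contradiction
    have h2 : ∀ u v, u ∈ S \ A → v ∈ S \ A → ¬ (edge r c₂).Adj u v := by
      intro u v hu hv h
      rw [Finset.mem_sdiff] at hu hv
      rw [edge_adj] at h
      rcases h with ⟨⟨-, rfl⟩ | ⟨rfl, -⟩, -⟩
      · exact hv.2 hc
      · exact hu.2 hc
    have key : ∀ {P Q P' Q' : SimpleGraph (Fin n)} {T T' : Finset (Fin n)}, Disjoint T T' →
        IsTreeOn T P → IsTreeOn T' Q' → (∀ u v, u ∈ T → v ∈ T → ¬ (edge r c₂).Adj u v) →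
        (∀ u v, P.Adj u v ∨ Q.Adj u v ∨ (edge r c₂).Adj u v →
          P'.Adj u v ∨ Q'.Adj u v ∨ (edge r c₂).Adj u v) → P ≤ P' := by
      intro P Q P' Q' T T' hT hP hQ' hno himp u v huv
      have hu := hP.mem_of_adj huv
      rcases himp u v (Or.inl huv) with h | h | h
      · exact h
      · exact (Finset.disjoint_left.1 hT hu (hQ'.mem_of_adj h)).elim
      · exact (hno u v hu (hP.mem_of_adj huv.symm) h).elim
    have hd : Disjoint A (S \ A) := Finset.disjoint_sdiff
    have e1 : Z = Z₂ := le_antisymm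
      (key (Q := Z') hd hZ hZ₂' h1 fun u v => by have := hadj u v; tauto)
      (key (Q := Z₂') hd hZ₂ hZ' h1 fun u v => by have := hadj u v; tauto)
    have e2 : Z' = Z₂' := le_antisymm
      (key (Q := Z) hd.symm hZ' hZ₂ h2 fun u v => by have := hadj u v; tauto)
      (key (Q := Z₂) hd.symm hZ₂' hZ h2 fun u v => by have := hadj u v; tauto)
    rw [e1, e2]
  · intro G hG
    obtain ⟨A, hAS, hmA, hrA, c, hc, Z, Z', hZ, hZ', rfl⟩ :=
      (mem_treesOn.1 hG).exists_eq_glue hr hm hne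
    refine ⟨⟨A, c, Z, Z'⟩, ?_, rfl⟩
    simp only [Finset.coe_sigma, Set.mem_sigma_iff, Finset.mem_coe, Finset.mem_filter,
      Finset.mem_powerset, Finset.mem_product, mem_treesOn]
    exact ⟨⟨hAS, hmA, hrA⟩, hc, hZ, hZ'⟩
  · rintro ⟨A, c, Z, Z'⟩ hp
    simp only [Finset.mem_sigma, Finset.mem_filter, Finset.mem_powerset, Finset.mem_product,
      mem_treesOn] at hp
    obtain ⟨⟨hAS, hmA, hrA⟩, hc, hZ, hZ'⟩ := hp
    rw [numTwists_glue hZ hZ' Finset.disjoint_sdiff hc (Finset.mem_sdiff.2 ⟨hr, hrA⟩)]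

end Counting

section Recurrence

open Polynomial

variable {n : ℕ}

theorem sum_powerset_filter_mem {V : Type*} [DecidableEq V] {S : Finset V} {a : V}
    (ha : a ∈ S) {k : ℕ} (hS : S.card = k + 1) (f : ℕ → ℚ[X]) :
    ∑ A ∈ S.powerset with a ∈ A, f A.card =
      ∑ i ∈ Finset.range (k + 1), (k.choose i : ℚ[X]) * f (i + 1) := by
  have hcard : (S.erase a).card = k := by rw [Finset.card_erase_of_mem ha, hS]; rfl
  have h := Finset.sum_powerset_apply_card (fun i => f (i + 1)) (x := S.erase a)
  rw [hcard] at h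
  simp only [nsmul_eq_mul] at h
  rw [← h]
  symm
  have hna : ∀ A ∈ (S.erase a).powerset, a ∉ A := fun A hA h =>
    Finset.notMem_erase _ _ (Finset.mem_powerset.1 hA h)
  refine Finset.sum_nbij' (insert a) (fun A => A.erase a) ?_ ?_ ?_ ?_ ?_
  · intro A hA
    rw [Finset.mem_powerset] at hA
    rw [Finset.mem_filter, Finset.mem_powerset]
    exact ⟨Finset.insert_subset ha (hA.trans (Finset.erase_subset _ _)), Finset.mem_insert_self _ _⟩
  · intro A hA
    rw [Finset.mem_filter, Finset.mem_powerset] at hA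
    exact Finset.mem_powerset.2 (Finset.erase_subset_erase _ hA.1)
  · exact fun A hA => Finset.erase_insert (hna A hA)
  · exact fun A hA => Finset.insert_erase (Finset.mem_filter.1 hA).2
  · exact fun A hA => by rw [Finset.card_insert_of_notMem (hna A hA)]

theorem sum_powerset_filter_mem_notMem {V : Type*} [DecidableEq V] {S : Finset V} {a b : V}
    (ha : a ∈ S) (hb : b ∈ S) (hab : a ≠ b) {k : ℕ} (hS : S.card = k + 2) (f : ℕ → ℚ[X]) :
    ∑ A ∈ S.powerset with a ∈ A ∧ b ∉ A, f A.card =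
      ∑ i ∈ Finset.range (k + 1), (k.choose i : ℚ[X]) * f (i + 1) := by
  rw [← sum_powerset_filter_mem (Finset.mem_erase.2 ⟨hab, ha⟩)
    (by rw [Finset.card_erase_of_mem hb, hS]; rfl)]
  refine Finset.sum_congr ?_ fun _ _ => rfl
  ext A
  simp only [Finset.mem_filter, Finset.mem_powerset, Finset.subset_erase]
  tauto

theorem twistPoly_eq (k : ℕ) : ∀ S : Finset (Fin n), S.card = k + 1 →
    ∑ r ∈ S, twistPoly S r = rootedTreePoly (k + 1) ∧
      ∀ m ∈ S, (∀ a ∈ S, m ≤ a) → twistPoly S m = rootedForestPoly k := by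
  induction k using Nat.strong_induction_on with
  | _ k ih =>
  intro S hS
  have ihR : ∀ A : Finset (Fin n), A.card < k + 1 →
      ∑ r ∈ A, twistPoly A r = rootedTreePoly A.card := by
    intro A hA
    rcases h : A.card with _ | i
    · rw [Finset.card_eq_zero.1 h, rootedTreePoly, Finset.sum_empty]
    · exact (ih i (by omega) A h).1
  have hmin : ∀ m ∈ S, (∀ a ∈ S, m ≤ a) → twistPoly S m = rootedForestPoly k := by
    intro m hm hle
    rcases k with _ | k
    · obtain ⟨x, rfl⟩ := Finset.card_eq_one.1 hS
      rw [Finset.mem_singleton.1 hm, twistPoly_singleton, rootedForestPoly]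
    · obtain ⟨b, hb⟩ : (S.erase m).Nonempty := by
        rw [← Finset.card_pos, Finset.card_erase_of_mem hm]
        omega
      obtain ⟨hbm, hb⟩ := Finset.mem_erase.1 hb
      have hsum := sum_powerset_filter_mem_notMem hb hm hbm hS
        fun i => rootedTreePoly i * rootedForestPoly (k + 1 - i)
      simp only [Nat.add_sub_add_right] at hsum
      rw [twistPoly_eq_sum_split hm hb hbm, rootedForestPoly_succ, ← hsum]
      refine Finset.sum_congr rfl fun A hA => ?_
      rw [Finset.mem_filter, Finset.mem_powerset] at hA
      obtain ⟨hAS, hbA, hmA⟩ := hA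
      have hlt : A.card < k + 2 :=
        hS ▸ Finset.card_lt_card ⟨hAS, fun h => hmA (h hm)⟩
      have hcard : (S \ A).card = (k + 1 - A.card) + 1 := by
        rw [Finset.card_sdiff_of_subset hAS, hS]; omega
      have hpos : 0 < A.card := Finset.card_pos.2 ⟨b, hbA⟩
      rw [if_neg, mul_one, ihR A hlt,
        (ih (k + 1 - A.card) (by omega) (S \ A) hcard).2 m (Finset.mem_sdiff.2 ⟨hm, hmA⟩)
          fun a ha => hle a (Finset.mem_sdiff.1 ha).1]
      rw [minLabel_lt_iff ⟨b, hbA⟩]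
      rintro ⟨a, ha, hlt⟩
      exact absurd (hle a (hAS ha)) (not_le.2 hlt)
  refine ⟨?_, hmin⟩
  have hne : S.Nonempty := Finset.card_pos.1 (by omega)
  obtain ⟨m, hm, hle⟩ : ∃ m ∈ S, ∀ a ∈ S, m ≤ a :=
    ⟨S.min' hne, S.min'_mem hne, fun a ha => S.min'_le a ha⟩
  rw [← Finset.add_sum_erase S _ hm, hmin m hm hle, rootedTreePoly_succ]
  congr 1
  have hsum := sum_powerset_filter_mem hm hS
    fun i => rootedTreePoly i * rootedTreePoly (k + 1 - i)
  simp only [Nat.add_sub_add_right] at hsum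
  rw [← hsum]
  have hsplit : ∀ r ∈ S.erase m, twistPoly S r = ∑ A ∈ S.powerset with m ∈ A ∧ r ∉ A,
      X * (rootedTreePoly A.card * twistPoly (S \ A) r) := by
    intro r hr
    obtain ⟨hrm, hr⟩ := Finset.mem_erase.1 hr
    rw [twistPoly_eq_sum_split hr hm hrm.symm]
    refine Finset.sum_congr rfl fun A hA => ?_
    rw [Finset.mem_filter, Finset.mem_powerset] at hA
    obtain ⟨hAS, hmA, hrA⟩ := hA
    rw [if_pos, ihR A (hS ▸ Finset.card_lt_card ⟨hAS, fun h => hrA (h hr)⟩), mul_comm]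
    rw [minLabel_lt_iff ⟨m, hmA⟩]
    exact ⟨m, hmA, Fin.lt_def.1 (lt_of_le_of_ne (hle r hr) hrm.symm)⟩
  rw [Finset.sum_congr rfl hsplit, Finset.sum_comm' (t' := S.powerset.filter (m ∈ ·))
    (s' := fun A => S \ A), Finset.mul_sum]
  · refine Finset.sum_congr rfl fun A hA => ?_
    rw [Finset.mem_filter, Finset.mem_powerset] at hA
    have hpos : 0 < A.card := Finset.card_pos.2 ⟨m, hA.2⟩
    have hcard : (S \ A).card = k + 1 - A.card := by
      rw [Finset.card_sdiff_of_subset hA.1, hS]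
    rw [← Finset.mul_sum, ← Finset.mul_sum, ihR (S \ A) (by omega), hcard]
  · intro r A
    simp only [Finset.mem_erase, Finset.mem_filter, Finset.mem_powerset, Finset.mem_sdiff]
    constructor
    · rintro ⟨⟨-, hr⟩, hA, hmA, hrA⟩
      exact ⟨⟨hr, hrA⟩, hA, hmA⟩
    · rintro ⟨⟨hr, hrA⟩, hA, hmA⟩
      exact ⟨⟨fun h => hrA (h ▸ hmA), hr⟩, hA, hmA, hrA⟩

theorem isTreeOn_univ_iff {G : SimpleGraph (Fin (n + 1))} :
    IsTreeOn Finset.univ G ↔ G.IsTree :=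
  ⟨fun h => ⟨⟨fun u v => h.reachable (Finset.mem_univ u) (Finset.mem_univ v)⟩, h.isAcyclic⟩,
    fun h => ⟨fun _ _ _ => Finset.mem_univ _, fun u _ v _ => h.connected.preconnected u v,
      h.isAcyclic⟩⟩

theorem numCayleyTwist_eq_coeff (m j : ℕ) (h : 0 < m + 1) :
    (numCayleyTwist (m + 1) j h : ℚ) = (rootedForestPoly m).coeff j := by
  classical
  rw [← (twistPoly_eq (n := m + 1) m Finset.univ (by simp)).2 ⟨0, h⟩ (Finset.mem_univ _)
    fun a _ => Fin.zero_le a, twistPoly, finsetSum_coeff]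
  simp only [coeff_X_pow]
  rw [Finset.sum_boole, numCayleyTwist, Nat.card_eq_fintype_card, Fintype.card_subtype]
  congr 2
  ext G
  rw [Finset.mem_filter, Finset.mem_filter, mem_treesOn, isTreeOn_univ_iff]
  simp [eq_comm]

end Recurrence

/-- The numbers `t(n,j)` of Cayley trees with `n` vertices and `j` twists satisfy the
recurrence `t(n,j) = (n-1)·t(n-1,j) + (n+j-3)·t(n-1,j-1)`. -/
theorem numCayleyTwist_recurrence :
    numCayleyTwist 1 0 Nat.one_pos = 1 ∧
    (∀ j : ℕ, 1 ≤ j → numCayleyTwist 1 j Nat.one_pos = 0) ∧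
    (∀ n : ℕ, ∀ hn : 2 ≤ n,
      numCayleyTwist n 0 (by omega) = (n - 1) * numCayleyTwist (n - 1) 0 (by omega) ∧
      ∀ j : ℕ, 1 ≤ j →
        numCayleyTwist n j (by omega) =
          (n - 1) * numCayleyTwist (n - 1) j (by omega) +
            (n + j - 3) * numCayleyTwist (n - 1) (j - 1) (by omega)) := by
  have hsucc : ∀ m j : ℕ, ∀ (h₁ : 0 < m + 2) (h₂ : 0 < m + 1),
      numCayleyTwist (m + 2) (j + 1) h₁ =
        (m + 1) * numCayleyTwist (m + 1) (j + 1) h₂ + (m + j) * numCayleyTwist (m + 1) j h₂ := by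
    intro m j h₁ h₂
    have h := congrArg (fun p => p.coeff (j + 1)) (rootedForestPoly_recurrence m)
    have hX : (1 + (m : Polynomial ℚ) + (m : Polynomial ℚ) * Polynomial.X) * rootedForestPoly m =
        Polynomial.C (1 + (m : ℚ)) * rootedForestPoly m +
          Polynomial.C (m : ℚ) * (rootedForestPoly m * Polynomial.X) := by
      simp only [map_add, map_one, map_natCast]; ring
    have hd : (Polynomial.X ^ 2 * Polynomial.derivative (rootedForestPoly m)).coeff (j + 1) =
        j * (rootedForestPoly m).coeff j := by
      rw [pow_two, mul_assoc, Polynomial.coeff_X_mul]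
      rcases j with _ | j
      · simp
      · rw [Polynomial.coeff_X_mul, Polynomial.coeff_derivative]; push_cast; ring
    simp only [Polynomial.coeff_add, hX, hd, Polynomial.coeff_C_mul, Polynomial.coeff_mul_X] at h
    rw [← numCayleyTwist_eq_coeff (m + 1) (j + 1) h₁, ← numCayleyTwist_eq_coeff m (j + 1) h₂,
      ← numCayleyTwist_eq_coeff m j h₂] at h
    have h' : (numCayleyTwist (m + 2) (j + 1) h₁ : ℚ) =
        ((m + 1) * numCayleyTwist (m + 1) (j + 1) h₂ + (m + j) * numCayleyTwist (m + 1) j h₂ : ℕ) := by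
      push_cast
      linear_combination h
    exact_mod_cast h'
  have hzero : ∀ m : ℕ, ∀ (h₁ : 0 < m + 2) (h₂ : 0 < m + 1),
      numCayleyTwist (m + 2) 0 h₁ = (m + 1) * numCayleyTwist (m + 1) 0 h₂ := by
    intro m h₁ h₂
    have h := congrArg (fun p => p.coeff 0) (rootedForestPoly_recurrence m)
    simp only [Polynomial.coeff_add, Polynomial.mul_coeff_zero] at h
    rw [← numCayleyTwist_eq_coeff (m + 1) 0 h₁, ← numCayleyTwist_eq_coeff m 0 h₂] at h
    have h' : (numCayleyTwist (m + 2) 0 h₁ : ℚ) =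
        ((m + 1) * numCayleyTwist (m + 1) 0 h₂ : ℕ) := by
      rw [h]
      simp [add_comm]
    exact_mod_cast h'
  have hone : ∀ j, (numCayleyTwist 1 j Nat.one_pos : ℚ) = (1 : Polynomial ℚ).coeff j := fun j => by
    rw [numCayleyTwist_eq_coeff 0 j Nat.one_pos, rootedForestPoly]
  refine ⟨?_, fun j hj => ?_, fun n hn => ?_⟩
  · have := hone 0
    rw [Polynomial.coeff_one_zero] at this
    exact_mod_cast this
  · have := hone j
    rw [Polynomial.coeff_one, if_neg (by omega)] at this
    exact_mod_cast this
  · obtain ⟨m, rfl⟩ := Nat.exists_eq_add_of_le' hn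
    refine ⟨hzero m _ _, fun j hj => ?_⟩
    obtain ⟨j, rfl⟩ := Nat.exists_eq_add_of_le' hj
    have e : m + 2 + (j + 1) - 3 = m + j := by omega
    rw [e]
    exact hsucc m j _ _
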